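/- For every real λ with −8 < λ < 0, the spectral density w₂(λ) := ∫_{−π}^{π}∫_{−π}^{π} (2π)^{-2} δ(λ + 4sin²(p₁/2) + 4sin²(p₂/2)) dp₁dp₂, understood as the density of the distribution of the random variable −4sin²(P₁/2) − 4sin²(P₂/2) with P₁,P₂ independent uniform on (−π,π), equals (1/2π²)·K(√(−λ(λ+8))/4), where K(k) = ∫₀¹ dx/√((1−x²)(1−k²x²)) is the complete elliptic integral of the first kind. -/

import Mathlib

open MeasureTheory Real

/-- The complete elliptic integral of the first kind,
`K(k) = ∫₀¹ dx/√((1−x²)(1−k²x²))`. -/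
noncomputable def ellipticK (k : ℝ) : ℝ :=
  ∫ x in (0:ℝ)..1, 1 / Real.sqrt ((1 - x ^ 2) * (1 - k ^ 2 * x ^ 2))

/-- The uniform probability measure on the square `(−π,π)²`. -/
noncomputable def unifSquare : Measure (ℝ × ℝ) :=
  (ENNReal.ofReal ((2 * Real.pi) ^ 2))⁻¹ •
    ((volume : Measure (ℝ × ℝ)).restrict
      (Set.Ioo (-Real.pi) Real.pi ×ˢ Set.Ioo (-Real.pi) Real.pi))

/-- The arcsine weight `1/√(1-x²)`, which vanishes for `|x| ≥ 1`. -/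
noncomputable def arcsineWeight (x : ℝ) : ENNReal :=
  ENNReal.ofReal (1 / Real.sqrt (1 - x ^ 2))

theorem measurable_arcsineWeight : Measurable arcsineWeight := by
  unfold arcsineWeight
  fun_prop

theorem arcsineWeight_eq_zero {x : ℝ} (hx : 1 ≤ |x|) : arcsineWeight x = 0 := by
  have h : 1 - x ^ 2 ≤ 0 := by
    have := (one_le_sq_iff_one_le_abs x).2 hx
    linarith
  simp [arcsineWeight, Real.sqrt_eq_zero_of_nonpos h]

theorem lintegral_eq_two_mul_Ioi_of_even {h : ℝ → ENNReal} (heven : ∀ y, h (-y) = h y) :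
    ∫⁻ y, h y = 2 * ∫⁻ y in Set.Ioi 0, h y := by
  have hneg : ∫⁻ y in Set.Iio 0, h y = ∫⁻ y in Set.Ioi 0, h y := by
    have := (Measure.measurePreserving_neg (volume : Measure ℝ)).setLIntegral_comp_preimage_emb
      (MeasurableEquiv.neg ℝ).measurableEmbedding h (Set.Iio 0)
    rw [← this]
    simp [heven]
  rw [← lintegral_add_compl h (measurableSet_Ioi (a := (0 : ℝ))), Set.compl_Ioi,
    setLIntegral_congr (Iio_ae_eq_Iic (μ := volume) (a := (0 : ℝ))).symm, hneg, two_mul]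

theorem image_cos_Ioo : Real.cos '' Set.Ioo 0 π = Set.Ioo (-1) 1 := by
  ext x
  constructor
  · rintro ⟨p, hp, rfl⟩
    have hs := Real.sin_pos_of_mem_Ioo hp
    have := Real.sin_sq_add_cos_sq p
    exact ⟨by nlinarith [sq_nonneg (Real.cos p - 1)], by nlinarith [sq_nonneg (Real.cos p + 1)]⟩
  · intro hx
    exact ⟨Real.arccos x, ⟨Real.arccos_pos.2 hx.2,
      lt_of_le_of_ne (Real.arccos_le_pi x) fun h => by linarith [Real.arccos_eq_pi.1 h, hx.1]⟩,
      Real.cos_arccos hx.1.le hx.2.le⟩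

theorem lintegral_arcsineWeight_mul (g : ℝ → ENNReal) :
    ∫⁻ x, arcsineWeight x * g x = ∫⁻ p in Set.Ioo 0 π, g (Real.cos p) := by
  have hsupp : ∫⁻ x, arcsineWeight x * g x =
      ∫⁻ x in Set.Ioo (-1) 1, arcsineWeight x * g x := by
    rw [← lintegral_indicator measurableSet_Ioo]
    congr 1
    ext x
    by_cases hx : x ∈ Set.Ioo (-1 : ℝ) 1
    · rw [Set.indicator_of_mem hx]
    · rw [Set.indicator_of_notMem hx, arcsineWeight_eq_zero, zero_mul]
      by_contra! h
      exact hx (abs_lt.1 h)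
  rw [hsupp, ← image_cos_Ioo, lintegral_image_eq_lintegral_abs_deriv_mul measurableSet_Ioo
    (fun p _ => (Real.hasDerivAt_cos p).hasDerivWithinAt)
    (Real.injOn_cos.mono Set.Ioo_subset_Icc_self)]
  refine setLIntegral_congr_fun measurableSet_Ioo fun p hp => ?_
  have hs := Real.sin_pos_of_mem_Ioo hp
  have hsq : 1 - Real.cos p ^ 2 = Real.sin p ^ 2 := by
    linarith [Real.sin_sq_add_cos_sq p]
  simp only [arcsineWeight]
  rw [hsq, Real.sqrt_sq hs.le, abs_neg, abs_of_pos hs, ← mul_assoc,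
    ← ENNReal.ofReal_mul hs.le, mul_one_div_cancel hs.ne', ENNReal.ofReal_one, one_mul]

theorem lintegral_cos (g : ℝ → ENNReal) :
    ∫⁻ p in Set.Ioo (-π) π, g (Real.cos p) = 2 * ∫⁻ x, arcsineWeight x * g x := by
  rw [lintegral_arcsineWeight_mul, ← lintegral_indicator measurableSet_Ioo,
    lintegral_eq_two_mul_Ioi_of_even, setLIntegral_indicator measurableSet_Ioo]
  · congr 3
    ext p
    simp only [Set.mem_inter_iff, Set.mem_Ioo, Set.mem_Ioi]
    constructor
    · rintro ⟨⟨_, h⟩, h'⟩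
      exact ⟨h', h⟩
    · rintro ⟨h', h⟩
      exact ⟨⟨by linarith, h⟩, h'⟩
  · intro p
    have : -p ∈ Set.Ioo (-π) π ↔ p ∈ Set.Ioo (-π) π := by
      simp only [Set.mem_Ioo]
      constructor <;> rintro ⟨h1, h2⟩ <;> constructor <;> linarith
    simp only [Set.indicator, this, Real.cos_neg]

theorem lintegral_lintegral_cos {f : ℝ → ENNReal} (hf : Measurable f) :
    ∫⁻ p in Set.Ioo (-π) π, ∫⁻ q in Set.Ioo (-π) π, f (2 * Real.cos p + 2 * Real.cos q - 4) =
      ∫⁻ l, f l * (2 * ∫⁻ x, arcsineWeight x * arcsineWeight ((l + 4) / 2 - x)) := by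
  have hw := measurable_arcsineWeight
  have hinner (x : ℝ) : ∫⁻ z, arcsineWeight z * f (2 * x + 2 * z - 4) =
      2⁻¹ * ∫⁻ l, f l * arcsineWeight ((l + 4) / 2 - x) := by
    have himage := lintegral_image_eq_lintegral_abs_deriv_mul (s := Set.univ)
      (f := fun z : ℝ => 2 * x + 2 * z - 4) (f' := fun _ => 2) MeasurableSet.univ
      (fun z _ => by
        have h := (((hasDerivAt_id z).const_mul 2).const_add (2 * x)).sub_const 4
        rw [mul_one] at h
        exact h.hasDerivWithinAt)
      (fun a _ b _ h => by simpa using h)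
      (fun l => f l * arcsineWeight ((l + 4) / 2 - x))
    have hrange : (fun z : ℝ => 2 * x + 2 * z - 4) '' Set.univ = Set.univ := by
      rw [Set.image_univ, Set.range_eq_univ]
      exact fun l => ⟨(l + 4) / 2 - x, by ring⟩
    rw [hrange, Measure.restrict_univ] at himage
    rw [himage, lintegral_const_mul _ (by fun_prop), ← mul_assoc]
    simp only [abs_two, ENNReal.ofReal_ofNat]
    rw [ENNReal.inv_mul_cancel (by simp) (by simp), one_mul]
    refine lintegral_congr fun z => ?_
    rw [show (2 * x + 2 * z - 4 + 4) / 2 - x = z by ring, mul_comm]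
  calc
    _ = ∫⁻ p in Set.Ioo (-π) π, (fun x => 2 * ∫⁻ z, arcsineWeight z * f (2 * x + 2 * z - 4))
          (Real.cos p) := by
        refine lintegral_congr fun p => ?_
        exact lintegral_cos fun z => f (2 * Real.cos p + 2 * z - 4)
    _ = 2 * ∫⁻ x, arcsineWeight x * ∫⁻ l, f l * arcsineWeight ((l + 4) / 2 - x) := by
        refine (lintegral_cos
          fun x => 2 * ∫⁻ z, arcsineWeight z * f (2 * x + 2 * z - 4)).trans ?_
        congr 1
        refine lintegral_congr fun x => ?_
        rw [hinner, ← mul_assoc 2, ENNReal.mul_inv_cancel (by simp) (by simp), one_mul]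
    _ = 2 * ∫⁻ x, ∫⁻ l, arcsineWeight x * (f l * arcsineWeight ((l + 4) / 2 - x)) := by
        congr 1
        refine lintegral_congr fun x => ?_
        rw [lintegral_const_mul _ (by fun_prop)]
    _ = 2 * ∫⁻ l, f l * ∫⁻ x, arcsineWeight x * arcsineWeight ((l + 4) / 2 - x) := by
        rw [lintegral_lintegral_swap (by fun_prop)]
        congr 1
        refine lintegral_congr fun l => ?_
        rw [← lintegral_const_mul _ (by fun_prop)]
        refine lintegral_congr fun x => ?_
        ring
    _ = _ := by
        rw [← lintegral_const_mul' _ _ (by simp)]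
        refine lintegral_congr fun l => ?_
        ring

theorem arcsineWeight_mul {x y : ℝ} (hx : x ^ 2 ≤ 1) :
    arcsineWeight x * arcsineWeight y =
      ENNReal.ofReal (1 / Real.sqrt ((1 - x ^ 2) * (1 - y ^ 2))) := by
  rw [arcsineWeight, arcsineWeight, ← ENNReal.ofReal_mul (by positivity), one_div_mul_one_div,
    Real.sqrt_mul (by linarith)]

/-- The image of `(0,c)` under the Landen substitution `y ↦ 2y/(cd+y²)`, where `c + d = 2`. -/
theorem image_landen {c d : ℝ} (hc : 0 < c) (hcd : c ≤ d) (hsum : c + d = 2) :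
    (fun y => 2 * y / (c * d + y ^ 2)) '' Set.Ioo 0 c = Set.Ioo 0 1 := by
  have hpos (y : ℝ) : 0 < c * d + y ^ 2 := by nlinarith [sq_nonneg y, mul_pos hc (hc.trans_le hcd)]
  apply Set.Subset.antisymm
  · rintro _ ⟨y, ⟨h0, h1⟩, rfl⟩
    refine ⟨div_pos (by linarith) (hpos y), (div_lt_one (hpos y)).2 ?_⟩
    nlinarith [mul_pos (sub_pos.2 h1) (sub_pos.2 (h1.trans_le hcd))]
  · have hcont : ContinuousOn (fun y => 2 * y / (c * d + y ^ 2)) (Set.Icc 0 c) :=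
      (Continuous.div (by fun_prop) (by fun_prop) fun y => (hpos y).ne').continuousOn
    have := intermediate_value_Ioo hc.le hcont
    have h1 : 2 * c / (c * d + c ^ 2) = 1 := by
      rw [div_eq_one_iff_eq (hpos c).ne', ← hsum]
      ring
    simpa [h1] using this

theorem injOn_landen {c d : ℝ} (hc : 0 < c) (hcd : c ≤ d) :
    Set.InjOn (fun y => 2 * y / (c * d + y ^ 2)) (Set.Ioo 0 c) := by
  have hpos (y : ℝ) : 0 < c * d + y ^ 2 := by nlinarith [sq_nonneg y, mul_pos hc (hc.trans_le hcd)]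
  intro a ha b hb hab
  simp only at hab
  rw [div_eq_div_iff (hpos a).ne' (hpos b).ne'] at hab
  have hlt : a * b < c * d := by nlinarith [ha.1, ha.2, hb.1, hb.2]
  have : (a - b) * (c * d - a * b) = 0 := by linarith
  rcases mul_eq_zero.1 this with h | h <;> linarith

/-- Landen's transformation of the complete elliptic integral of modulus `√(cd)`. -/
theorem lintegral_landen {c d : ℝ} (hc : 0 < c) (hcd : c ≤ d) (hsum : c + d = 2) :
    ∫⁻ t in Set.Ioo 0 1, ENNReal.ofReal (1 / Real.sqrt ((1 - t ^ 2) * (1 - c * d * t ^ 2))) =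
      2 * ∫⁻ y in Set.Ioo 0 c,
        ENNReal.ofReal (1 / Real.sqrt ((c ^ 2 - y ^ 2) * (d ^ 2 - y ^ 2))) := by
  have hpos (y : ℝ) : 0 < c * d + y ^ 2 := by nlinarith [sq_nonneg y, mul_pos hc (hc.trans_le hcd)]
  rw [← image_landen hc hcd hsum, lintegral_image_eq_lintegral_abs_deriv_mul measurableSet_Ioo
    (f' := fun y => 2 * (c * d - y ^ 2) / (c * d + y ^ 2) ^ 2) ?_ (injOn_landen hc hcd),
    ← lintegral_const_mul' _ _ (by simp)]
  · refine setLIntegral_congr_fun measurableSet_Ioo fun y hy => ?_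
    have hN : 0 < c * d - y ^ 2 := by nlinarith [hy.1, hy.2]
    have hD := hpos y
    have hc2 : 0 < c ^ 2 - y ^ 2 := by nlinarith [hy.1, hy.2]
    have hd2 : 0 < d ^ 2 - y ^ 2 := by nlinarith [hy.1, hy.2]
    have hP := mul_pos hc2 hd2
    have hmod : (1 - (2 * y / (c * d + y ^ 2)) ^ 2) *
        (1 - c * d * (2 * y / (c * d + y ^ 2)) ^ 2) =
        ((c ^ 2 - y ^ 2) * (d ^ 2 - y ^ 2)) *
          ((c * d - y ^ 2) / (c * d + y ^ 2) ^ 2) ^ 2 := by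
      obtain rfl : d = 2 - c := by linarith
      field_simp
      ring
    rw [hmod, Real.sqrt_mul hP.le, Real.sqrt_sq (by positivity), abs_of_pos (by positivity),
      ← ENNReal.ofReal_mul (by positivity), ← ENNReal.ofReal_ofNat 2,
      ← ENNReal.ofReal_mul (by positivity)]
    congr 1
    have := Real.sqrt_pos.2 hP
    field_simp
  · intro y _
    have h := ((hasDerivAt_id y).const_mul 2).div
      (((hasDerivAt_id y).pow 2).const_add (c * d)) (hpos y).ne'
    refine (h.congr_deriv ?_).hasDerivWithinAt
    simp only [Pi.pow_apply, id, Nat.cast_ofNat]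
    ring

theorem lintegral_arcsineWeight_convolution {s : ℝ} (hs : |s| < 2) :
    ∫⁻ x, arcsineWeight x * arcsineWeight (s - x) =
      ∫⁻ t in Set.Ioo 0 1,
        ENNReal.ofReal (1 / Real.sqrt ((1 - t ^ 2) * (1 - (1 - s ^ 2 / 4) * t ^ 2))) := by
  have ha := abs_nonneg s
  have hsq := sq_abs s
  have hk : 1 - s ^ 2 / 4 = (1 - |s| / 2) * (1 + |s| / 2) := by rw [← hsq]; ring
  rw [hk, lintegral_landen (by linarith) (by linarith) (by ring),
    ← lintegral_add_right_eq_self _ (s / 2), lintegral_eq_two_mul_Ioi_of_even]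
  · congr 1
    rw [← lintegral_indicator measurableSet_Ioi, ← lintegral_indicator measurableSet_Ioo]
    refine lintegral_congr fun y => ?_
    by_cases hy : 0 < y
    · rw [Set.indicator_of_mem (Set.mem_Ioi.2 hy)]
      by_cases hyc : y < 1 - |s| / 2
      · rw [Set.indicator_of_mem (Set.mem_Ioo.2 ⟨hy, hyc⟩), arcsineWeight_mul]
        · congr 3
          rcases abs_choice s with h | h <;> rw [h] <;> ring
        · rw [sq_le_one_iff_abs_le_one, abs_le]
          constructor <;> linarith [neg_abs_le s, le_abs_self s]
      · rw [Set.indicator_of_notMem (fun h => hyc h.2)]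
        rcases abs_choice s with h | h
        · rw [arcsineWeight_eq_zero, zero_mul]
          exact le_trans (by linarith) (le_abs_self _)
        · rw [mul_comm, arcsineWeight_eq_zero, zero_mul]
          exact le_trans (by linarith) (neg_le_abs _)
    · rw [Set.indicator_of_notMem (by simpa using hy),
        Set.indicator_of_notMem (fun h => hy h.1)]
  · intro y
    rw [mul_comm]
    congr 2 <;> ring

theorem ofReal_ellipticK {k : ℝ} (hk : k ^ 2 < 1) :
    ENNReal.ofReal (ellipticK k) = ∫⁻ t in Set.Ioo 0 1,
      ENNReal.ofReal (1 / Real.sqrt ((1 - t ^ 2) * (1 - k ^ 2 * t ^ 2))) := by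
  have hfin : ∫⁻ t in Set.Ioo 0 1,
      ENNReal.ofReal (1 / Real.sqrt ((1 - t ^ 2) * (1 - k ^ 2 * t ^ 2))) < ⊤ := by
    calc
      _ ≤ ∫⁻ t in Set.Ioo 0 1, ENNReal.ofReal (1 / Real.sqrt (1 - k ^ 2)) * arcsineWeight t := by
          refine setLIntegral_mono' measurableSet_Ioo fun t ht => ?_
          have h1 : 0 < 1 - t ^ 2 := by nlinarith [ht.1, ht.2]
          have h2 : 1 - k ^ 2 ≤ 1 - k ^ 2 * t ^ 2 := by nlinarith [sq_nonneg k]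
          have h3 : 0 < 1 - k ^ 2 := by linarith
          rw [arcsineWeight, ← ENNReal.ofReal_mul (by positivity), one_div_mul_one_div,
            ← Real.sqrt_mul h3.le, mul_comm (1 - k ^ 2)]
          gcongr
      _ = ENNReal.ofReal (1 / Real.sqrt (1 - k ^ 2)) * ∫⁻ t in Set.Ioo 0 1, arcsineWeight t :=
          lintegral_const_mul' _ _ ENNReal.ofReal_ne_top
      _ ≤ ENNReal.ofReal (1 / Real.sqrt (1 - k ^ 2)) * ∫⁻ t, arcsineWeight t := by
          gcongr
          exact Measure.restrict_le_self
      _ < ⊤ := by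
          have := lintegral_arcsineWeight_mul fun _ => 1
          simp only [mul_one] at this
          rw [this]
          refine ENNReal.mul_lt_top ENNReal.ofReal_lt_top ?_
          simp
  rw [ellipticK, intervalIntegral.integral_of_le zero_le_one, integral_Ioc_eq_integral_Ioo,
    integral_eq_lintegral_of_nonneg_ae (Filter.Eventually.of_forall fun t => by positivity)
      (Measurable.aestronglyMeasurable (by fun_prop)), ENNReal.ofReal_toReal hfin.ne]

/-- The distribution of the symbol of the square-lattice Laplacian on the torus. -/
theorem map_unifSquare :
    Measure.map
        (fun p : ℝ × ℝ => -4 * Real.sin (p.1 / 2) ^ 2 - 4 * Real.sin (p.2 / 2) ^ 2) unifSquare =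
      (volume : Measure ℝ).withDensity fun l => (ENNReal.ofReal ((2 * π) ^ 2))⁻¹ *
        (2 * ∫⁻ x, arcsineWeight x * arcsineWeight ((l + 4) / 2 - x)) := by
  have hw := measurable_arcsineWeight
  have hsin (p : ℝ) : Real.sin (p / 2) ^ 2 = (1 - Real.cos p) / 2 := by
    rw [Real.sin_sq_eq_half_sub, mul_div_cancel₀ p two_ne_zero]
    ring
  have hmeas : Measurable fun l => 2 * ∫⁻ x, arcsineWeight x * arcsineWeight ((l + 4) / 2 - x) :=
    Measurable.const_mul (Measurable.lintegral_prod_right (by fun_prop)) _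
  refine Measure.ext_of_lintegral _ fun f hf => ?_
  rw [lintegral_map hf (by fun_prop), unifSquare, lintegral_smul_measure,
    lintegral_withDensity_eq_lintegral_mul _ (hmeas.const_mul _) hf, Measure.volume_eq_prod,
    ← Measure.prod_restrict, lintegral_prod _ (by fun_prop)]
  have hrw (p q : ℝ) : -4 * Real.sin (p / 2) ^ 2 - 4 * Real.sin (q / 2) ^ 2 =
      2 * Real.cos p + 2 * Real.cos q - 4 := by
    rw [hsin, hsin]
    ring
  simp only [hrw]
  rw [lintegral_lintegral_cos hf, smul_eq_mul, ← lintegral_const_mul' _ _ (by simp)]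
  refine lintegral_congr fun l => ?_
  simp only [Pi.mul_apply]
  ring

/-- On `(−8,0)`, the distribution of `−4 sin²(P₁/2) − 4 sin²(P₂/2)` (with `P₁,P₂`
independent uniform on `(−π,π)`) is absolutely continuous with density
`w₂(λ) = (1/2π²) K(√(−λ(λ+8))/4)`. -/
theorem spectral_density_w2 :
    (Measure.map
        (fun p : ℝ × ℝ => -4 * Real.sin (p.1 / 2) ^ 2 - 4 * Real.sin (p.2 / 2) ^ 2)
        unifSquare).restrict (Set.Ioo (-8 : ℝ) 0)
      = ((volume : Measure ℝ).restrict (Set.Ioo (-8 : ℝ) 0)).withDensity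
          (fun lam => ENNReal.ofReal
            ((1 / (2 * Real.pi ^ 2)) * ellipticK (Real.sqrt (-lam * (lam + 8)) / 4))) := by
  rw [map_unifSquare, restrict_withDensity measurableSet_Ioo]
  refine withDensity_congr_ae ?_
  have hne : ∀ᵐ l : ℝ ∂(volume.restrict (Set.Ioo (-8) 0)), l ≠ -4 :=
    ae_restrict_of_ae (Measure.ae_ne volume (-4))
  filter_upwards [ae_restrict_mem measurableSet_Ioo, hne] with l hl hl4
  have hnonneg : 0 ≤ -l * (l + 8) := by nlinarith [hl.1, hl.2]
  have hk : (Real.sqrt (-l * (l + 8)) / 4) ^ 2 = 1 - ((l + 4) / 2) ^ 2 / 4 := by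
    rw [div_pow, Real.sq_sqrt hnonneg]
    ring
  have hlt : (Real.sqrt (-l * (l + 8)) / 4) ^ 2 < 1 := by
    have : l + 4 ≠ 0 := fun h => hl4 (by linarith)
    rw [hk]
    have : 0 < ((l + 4) / 2) ^ 2 / 4 := by positivity
    linarith
  have hs : |(l + 4) / 2| < 2 := by
    rw [abs_lt]
    constructor <;> linarith [hl.1, hl.2]
  rw [lintegral_arcsineWeight_convolution hs, ENNReal.ofReal_mul (by positivity),
    ofReal_ellipticK hlt, hk, ← mul_assoc]
  congr 1
  rw [← ENNReal.ofReal_inv_of_pos (by positivity), ← ENNReal.ofReal_ofNat 2,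
    ← ENNReal.ofReal_mul (by positivity)]
  congr 1
  field_simp
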